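/- Let Qbar be a fixed algebraic closure of ℚ, F ⊂ Qbar a number field of degree r, Σ = Hom_{ℚ-alg}(F, Qbar), and ℓ a prime. Let T = (lim_n μ_{ℓ^n}((F ⊗_ℚ Qbar)ˣ)) ⊗_{ℤ_ℓ} ℚ_ℓ, with Gal(Qbar/ℚ) acting via σ ↦ id_F ⊗ σ, and let V = (lim_n μ_{ℓ^n}(Qbar)) ⊗_{ℤ_ℓ} ℚ_ℓ with its natural Gal(Qbar/ℚ)-action. Let Gal(Qbar/ℚ) act on the ℚ_ℓ-vector space Σ → V by ((σ · f)(τ)) = σ(f(σ⁻¹ ∘ τ)), where σ⁻¹ ∘ τ ∈ Σ is the composite of the embedding τ with the automorphism σ⁻¹. Then there is a ℚ_ℓ-linear, Gal(Qbar/ℚ)-equivariant isomorphism T ≅ (Σ → V). -/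

import Mathlib

/-!
STATEMENT 7: Let `Qbar` be a fixed algebraic closure of `ℚ`, `F ⊂ Qbar` a number field of
degree `r`, `Σ = Hom_{ℚ-alg}(F, Qbar)`, and `ℓ` a prime.  Let
`T = (lim_n μ_{ℓ^n}((F ⊗_ℚ Qbar)ˣ)) ⊗_{ℤ_ℓ} ℚ_ℓ` with `Gal(Qbar/ℚ)` acting via
`σ ↦ id_F ⊗ σ`, and `V = (lim_n μ_{ℓ^n}(Qbar)) ⊗_{ℤ_ℓ} ℚ_ℓ` with its natural
`Gal(Qbar/ℚ)`-action.  Let `Gal(Qbar/ℚ)` act on `Σ → V` by `(σ • f)(τ) = σ (f (σ⁻¹ ∘ τ))`.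
Then there is a `ℚ_ℓ`-linear, `Gal(Qbar/ℚ)`-equivariant isomorphism `T ≅ (Σ → V)`.
-/

open scoped TensorProduct

set_option synthInstance.maxHeartbeats 1000000
set_option maxHeartbeats 1000000

noncomputable section


variable (ℓ : ℕ) [Fact ℓ.Prime]

/-- The subgroup of `∏_n U` consisting of compatible sequences of `ℓ^n`-th roots of unity:
`f n ∈ μ_{ℓ^n}(U)` and `f (n+1) ^ ℓ = f n`.  This is the inverse limit `lim_n μ_{ℓ^n}`
along the `ℓ`-th power maps. -/
def tateSubgroup (U : Type) [CommGroup U] : Subgroup (ℕ → U) where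
  carrier := {f | (∀ n, f n ^ ℓ ^ n = 1) ∧ ∀ n, f (n + 1) ^ ℓ = f n}
  one_mem' := ⟨fun _ => one_pow _, fun _ => one_pow _⟩
  mul_mem' := fun {a b} ha hb =>
    ⟨fun n => by rw [Pi.mul_apply, mul_pow, ha.1 n, hb.1 n, one_mul],
     fun n => by rw [Pi.mul_apply, mul_pow, ha.2 n, hb.2 n]; rfl⟩
  inv_mem' := fun {a} ha =>
    ⟨fun n => by rw [Pi.inv_apply, inv_pow, ha.1 n, inv_one],
     fun n => by rw [Pi.inv_apply, inv_pow, ha.2 n]; rfl⟩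

/-- The `ℓ`-adic Tate module `lim_n μ_{ℓ^n}(U)` (written additively). -/
abbrev TateModule (U : Type) [CommGroup U] : Type := Additive (tateSubgroup ℓ U)

variable {U : Type} [CommGroup U]

/-- The underlying sequence of an element of the Tate module. -/
def TateModule.seq (f : TateModule ℓ U) : ℕ → U :=
  ((@Additive.toMul (tateSubgroup ℓ U) f : tateSubgroup ℓ U) : ℕ → U)

lemma TateModule.seq_pow (f : TateModule ℓ U) (n : ℕ) : f.seq ℓ n ^ ℓ ^ n = 1 :=
  (@Additive.toMul (tateSubgroup ℓ U) f).2.1 n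

lemma TateModule.ext {f g : TateModule ℓ U} (h : ∀ n, f.seq ℓ n = g.seq ℓ n) : f = g :=
  Subtype.ext (funext h)

lemma TateModule.seq_add (f g : TateModule ℓ U) (n : ℕ) :
    (f + g).seq ℓ n = f.seq ℓ n * g.seq ℓ n := rfl

lemma TateModule.seq_zero (n : ℕ) : (0 : TateModule ℓ U).seq ℓ n = 1 := rfl

lemma TateModule.seq_succ_pow (f : TateModule ℓ U) (n : ℕ) :
    f.seq ℓ (n + 1) ^ ℓ = f.seq ℓ n :=
  (@Additive.toMul (tateSubgroup ℓ U) f).2.2 n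

/-- The scalar multiplication of `ℤ_ℓ` on the Tate module: in the `n`-th component, a scalar
acts through its image in `ℤ/ℓ^n`. -/
instance : SMul ℤ_[ℓ] (TateModule ℓ U) :=
  ⟨fun c f => Additive.ofMul (α := tateSubgroup ℓ U)
    ⟨fun n => f.seq ℓ n ^ (PadicInt.toZModPow n c).val,
     ⟨fun n => by
        show (f.seq ℓ n ^ (PadicInt.toZModPow n c).val) ^ ℓ ^ n = 1
        rw [← pow_mul, mul_comm, pow_mul, f.seq_pow ℓ n, one_pow],
      fun n => by
        show (f.seq ℓ (n + 1) ^ (PadicInt.toZModPow (n + 1) c).val) ^ ℓ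
          = f.seq ℓ n ^ (PadicInt.toZModPow n c).val
        have hcast : (PadicInt.toZModPow n c).val
            = (PadicInt.toZModPow (n + 1) c).val % ℓ ^ n := by
          haveI : NeZero (ℓ ^ (n + 1)) :=
            ⟨(pow_pos (Fact.out : ℓ.Prime).pos (n + 1)).ne'⟩
          rw [← PadicInt.cast_toZModPow n (n + 1) (Nat.le_succ n) c,
            ← ZMod.natCast_val, ZMod.val_natCast]
        rw [← pow_mul, mul_comm, pow_mul, f.seq_succ_pow ℓ n, hcast,
          ← pow_eq_pow_mod _ (f.seq_pow ℓ n)]⟩⟩⟩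

lemma TateModule.seq_smul (c : ℤ_[ℓ]) (f : TateModule ℓ U) (n : ℕ) :
    (c • f).seq ℓ n = f.seq ℓ n ^ (PadicInt.toZModPow n c).val := rfl

instance : Module ℤ_[ℓ] (TateModule ℓ U) where
  one_smul f := TateModule.ext ℓ fun n => by
    haveI : NeZero (ℓ ^ n) := ⟨(pow_pos (Fact.out : ℓ.Prime).pos n).ne'⟩
    rw [TateModule.seq_smul, map_one, ← Nat.cast_one, ZMod.val_natCast,
      ← pow_eq_pow_mod _ (TateModule.seq_pow ℓ f n), pow_one]
  mul_smul a b f := TateModule.ext ℓ fun n => by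
    haveI : NeZero (ℓ ^ n) := ⟨(pow_pos (Fact.out : ℓ.Prime).pos n).ne'⟩
    rw [TateModule.seq_smul, TateModule.seq_smul, TateModule.seq_smul, map_mul,
      ZMod.val_mul, ← pow_eq_pow_mod _ (TateModule.seq_pow ℓ f n), ← pow_mul, mul_comm, pow_mul]
  smul_zero c := TateModule.ext ℓ fun n => by
    rw [TateModule.seq_smul, TateModule.seq_zero, one_pow]
  smul_add c f g := TateModule.ext ℓ fun n => by
    rw [TateModule.seq_smul, TateModule.seq_add, TateModule.seq_add, TateModule.seq_smul,
      TateModule.seq_smul, mul_pow]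
  add_smul a b f := TateModule.ext ℓ fun n => by
    haveI : NeZero (ℓ ^ n) := ⟨(pow_pos (Fact.out : ℓ.Prime).pos n).ne'⟩
    rw [TateModule.seq_smul, TateModule.seq_add, TateModule.seq_smul, TateModule.seq_smul,
      map_add, ZMod.val_add, ← pow_eq_pow_mod _ (TateModule.seq_pow ℓ f n), pow_add]
  zero_smul f := TateModule.ext ℓ fun n => by
    rw [TateModule.seq_smul, TateModule.seq_zero, map_zero, ZMod.val_zero, pow_zero]

/-- The natural representation of the automorphism group of `U` on the Tate module
`lim_n μ_{ℓ^n}(U)`, over `ℤ_ℓ`. -/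
def tateAutRep (U : Type) [CommGroup U] :
    Representation ℤ_[ℓ] (MulAut U) (TateModule ℓ U) where
  toFun e :=
    { toFun := fun f => Additive.ofMul (α := tateSubgroup ℓ U)
        ⟨fun n => e (f.seq ℓ n),
         ⟨fun n => by
            show e (f.seq ℓ n) ^ ℓ ^ n = 1
            rw [← map_pow, f.seq_pow ℓ n, map_one],
          fun n => by
            show e (f.seq ℓ (n + 1)) ^ ℓ = e (f.seq ℓ n)
            rw [← map_pow, f.seq_succ_pow ℓ n]⟩⟩
      map_add' := fun f g => TateModule.ext ℓ fun n => by
        show e ((f + g).seq ℓ n) = e (f.seq ℓ n) * e (g.seq ℓ n)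
        rw [TateModule.seq_add, map_mul]
      map_smul' := fun c f => TateModule.ext ℓ fun n => by
        show e ((c • f).seq ℓ n) = e (f.seq ℓ n) ^ (PadicInt.toZModPow n c).val
        rw [TateModule.seq_smul, map_pow] }
  map_one' := LinearMap.ext fun f => TateModule.ext ℓ fun n => rfl
  map_mul' e₁ e₂ := LinearMap.ext fun f => TateModule.ext ℓ fun n => rfl

/-- Base change of a `ℤ_ℓ`-linear representation to `ℚ_ℓ = ℚ_ℓ ⊗_{ℤ_ℓ} ℤ_ℓ`. -/
def repBaseChange {G M : Type} [Monoid G] [AddCommGroup M] [Module ℤ_[ℓ] M]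
    (ρ : Representation ℤ_[ℓ] G M) : Representation ℚ_[ℓ] G (ℚ_[ℓ] ⊗[ℤ_[ℓ]] M) :=
  ((Module.End.baseChangeHom ℤ_[ℓ] ℚ_[ℓ] M).toRingHom.toMonoidHom).comp ρ


/-- A fixed algebraic closure of `ℚ`. -/
abbrev Qbar : Type := AlgebraicClosure ℚ

/-- The action on units induced by `R`-algebra automorphisms of `A`, as a group
homomorphism to the automorphism group of `Aˣ`. -/
def algAutToUnitsAut (R A : Type) [CommSemiring R] [Semiring A] [Algebra R A] :
    (A ≃ₐ[R] A) →* MulAut Aˣ where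
  toFun e := Units.mapEquiv e.toRingEquiv.toMulEquiv
  map_one' := by
    ext u
    rfl
  map_mul' e₁ e₂ := by
    ext u
    rfl

variable (F : IntermediateField ℚ Qbar)

noncomputable instance : CommGroup (F ⊗[ℚ] Qbar)ˣ := by
  exact @Units.instCommGroupUnits (F ⊗[ℚ] Qbar) inferInstance

/-- The group homomorphism `Gal(Qbar/ℚ) → Aut_{F-alg}(F ⊗_ℚ Qbar)`, `σ ↦ id_F ⊗ σ`. -/
def iota : (Qbar ≃ₐ[ℚ] Qbar) →* ((F ⊗[ℚ] Qbar) ≃ₐ[F] (F ⊗[ℚ] Qbar)) where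
  toFun σ := Algebra.TensorProduct.congr AlgEquiv.refl σ
  map_one' := Algebra.TensorProduct.congr_refl
  map_mul' σ τ := Algebra.TensorProduct.congr_trans AlgEquiv.refl AlgEquiv.refl τ σ

/-- The representation of `Gal(Qbar/ℚ)` on
`T = (lim_n μ_{ℓ^n}((F ⊗_ℚ Qbar)ˣ)) ⊗_{ℤ_ℓ} ℚ_ℓ`, acting via `σ ↦ id_F ⊗ σ` on the
`ℓ`-power roots of unity of the ring `F ⊗_ℚ Qbar`. -/
def tateRepT :
    Representation ℚ_[ℓ] (Qbar ≃ₐ[ℚ] Qbar)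
      (ℚ_[ℓ] ⊗[ℤ_[ℓ]] TateModule ℓ ((F ⊗[ℚ] Qbar)ˣ)) :=
  (repBaseChange ℓ
      ((tateAutRep ℓ ((F ⊗[ℚ] Qbar)ˣ)).comp (algAutToUnitsAut F (F ⊗[ℚ] Qbar)))).comp
    (iota F)

/-- The natural representation of `Gal(Qbar/ℚ)` on
`V = (lim_n μ_{ℓ^n}(Qbar)) ⊗_{ℤ_ℓ} ℚ_ℓ`, i.e. `ℚ_ℓ(1)`. -/
def tateRepV :
    Representation ℚ_[ℓ] (Qbar ≃ₐ[ℚ] Qbar) (ℚ_[ℓ] ⊗[ℤ_[ℓ]] TateModule ℓ Qbarˣ) :=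
  repBaseChange ℓ ((tateAutRep ℓ Qbarˣ).comp (algAutToUnitsAut ℚ Qbar))

/-- Precomposition action of `Gal(Qbar/ℚ)` on `Σ = Hom_{ℚ-alg}(F, Qbar)`:
`σ • τ = σ ∘ τ`. -/
def galOnSigma (σ : Qbar ≃ₐ[ℚ] Qbar) (τ : F →ₐ[ℚ] Qbar) : F →ₐ[ℚ] Qbar :=
  ((σ : Qbar →ₐ[ℚ] Qbar)).comp τ

lemma galOnSigma_one (τ : F →ₐ[ℚ] Qbar) : galOnSigma F 1 τ = τ :=
  AlgHom.ext fun _ => rfl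

lemma galOnSigma_mul (σ σ' : Qbar ≃ₐ[ℚ] Qbar) (τ : F →ₐ[ℚ] Qbar) :
    galOnSigma F (σ * σ') τ = galOnSigma F σ (galOnSigma F σ' τ) :=
  AlgHom.ext fun _ => rfl

/-- The representation of `Gal(Qbar/ℚ)` on `Σ → V`, `Σ = Hom_{ℚ-alg}(F, Qbar)`, given by
`(σ • f)(τ) = σ (f (σ⁻¹ ∘ τ))`: the representation induced from `ℚ_ℓ(1)`. -/
def inducedRep :
    Representation ℚ_[ℓ] (Qbar ≃ₐ[ℚ] Qbar)
      ((F →ₐ[ℚ] Qbar) → ℚ_[ℓ] ⊗[ℤ_[ℓ]] TateModule ℓ Qbarˣ) where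
  toFun σ :=
    { toFun := fun f τ => tateRepV ℓ σ (f (galOnSigma F σ⁻¹ τ))
      map_add' := fun f g => funext fun τ => by
        simp only [Pi.add_apply, map_add]
      map_smul' := fun c f => funext fun τ => by
        simp only [Pi.smul_apply, map_smul, RingHom.id_apply] }
  map_one' := LinearMap.ext fun f => funext fun τ => by
    simp only [LinearMap.coe_mk, AddHom.coe_mk, inv_one, galOnSigma_one, map_one]
    rfl
  map_mul' σ σ' := LinearMap.ext fun f => funext fun τ => by
    simp only [LinearMap.coe_mk, AddHom.coe_mk, mul_inv_rev, galOnSigma_mul, map_mul]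
    rfl

section helpers

/-- The canonical map `L ⊗ E → L^Σ` is bijective. -/
lemma aux_bij (K E L : Type) [Field K] [Field E] [Field L] [Algebra K E] [Algebra K L]
    [FiniteDimensional K E] [Algebra.IsSeparable K E] [IsAlgClosed L] :
    Function.Bijective (Algebra.TensorProduct.lift (Algebra.ofId L ((E →ₐ[K] L) → L))
      (Pi.algHom K (fun _ : E →ₐ[K] L => L) (fun τ => τ)) (fun _ _ => Commute.all _ _) :
        L ⊗[K] E →ₐ[L] ((E →ₐ[K] L) → L)) := by
  classical
  set Ψ : L ⊗[K] E →ₐ[L] ((E →ₐ[K] L) → L) :=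
    Algebra.TensorProduct.lift (Algebra.ofId L ((E →ₐ[K] L) → L))
      (Pi.algHom K (fun _ : E →ₐ[K] L => L) (fun τ => τ)) (fun _ _ => Commute.all _ _) with hΨ
  have hval : ∀ (a : E) (τ : E →ₐ[K] L), Ψ (1 ⊗ₜ a) τ = τ a := by
    intro a τ
    simp [hΨ]
  have hsurj : Function.Surjective Ψ.toLinearMap := by
    rw [← LinearMap.range_eq_top]
    by_contra hne
    obtain ⟨f, hf0, hf⟩ := Submodule.exists_le_ker_of_lt_top _ (lt_top_iff_ne_top.mpr hne)
    apply hf0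
    have hli := linearIndependent_toLinearMap K E L
    rw [Fintype.linearIndependent_iff] at hli
    have hf' : ∀ x : (E →ₐ[K] L) → L, f x = ∑ τ, x τ * f (Pi.single τ 1) := by
      intro x
      have := LinearMap.pi_apply_eq_sum_univ f x
      rw [this]
      refine Finset.sum_congr rfl fun τ _ => ?_
      rw [smul_eq_mul]
      congr 2
      ext j
      simp [Pi.single_apply, eq_comm]
    have h0 := hli (fun τ => f (Pi.single τ 1)) (by
      ext a
      have h1 : f (Ψ (1 ⊗ₜ a)) = 0 := hf ⟨1 ⊗ₜ a, rfl⟩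
      rw [hf'] at h1
      simp only [hval] at h1
      simpa [LinearMap.sum_apply, mul_comm] using h1)
    ext x
    simp [h0]
  have hfin : Module.finrank L (L ⊗[K] E) = Module.finrank L ((E →ₐ[K] L) → L) := by
    rw [Module.finrank_baseChange, Module.finrank_fintype_fun_eq_card, AlgHom.card]
  exact ⟨(LinearMap.injective_iff_surjective_of_finrank_eq_finrank hfin).mpr hsurj, hsurj⟩

/-- The `τ`-component `a ⊗ b ↦ τ a * b`. -/
def phi (τ : F →ₐ[ℚ] Qbar) : F ⊗[ℚ] Qbar →ₐ[ℚ] Qbar :=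
  Algebra.TensorProduct.lift τ (AlgHom.id ℚ Qbar) (fun _ _ => Commute.all _ _)

lemma phi_tmul (τ : F →ₐ[ℚ] Qbar) (a : F) (b : Qbar) : phi F τ (a ⊗ₜ b) = τ a * b := by
  simp [phi]

lemma phi_bij [FiniteDimensional ℚ F] :
    Function.Bijective (fun x : F ⊗[ℚ] Qbar => fun τ : F →ₐ[ℚ] Qbar => phi F τ x) := by
  have h := (aux_bij ℚ F Qbar).comp (Algebra.TensorProduct.comm ℚ F Qbar).bijective
  convert h using 1
  funext x τ
  induction x with
  | zero => simp
  | add x y hx hy => simp only [map_add, Function.comp_apply, Pi.add_apply, hx, hy]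
  | tmul a b => simp [phi_tmul, mul_comm]

lemma units_bij {A B ι : Type} [Monoid A] [Monoid B] (g : ι → A →* B)
    (h : Function.Bijective (fun x : A => fun i => g i x)) :
    Function.Bijective (fun x : Aˣ => fun i => Units.map (g i) x) := by
  let e : A ≃* (ι → B) := MulEquiv.ofBijective (Pi.monoidHom g) h
  exact ((Units.mapEquiv e).trans MulEquiv.piUnits).bijective

/-- Functoriality of the Tate module. -/
def tateMap {U V : Type} [CommGroup U] [CommGroup V] (g : U →* V) :
    TateModule ℓ U →ₗ[ℤ_[ℓ]] TateModule ℓ V where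
  toFun f := Additive.ofMul (α := tateSubgroup ℓ V)
    ⟨fun n => g (f.seq ℓ n),
      ⟨fun n => by
          show g (f.seq ℓ n) ^ ℓ ^ n = 1
          rw [← map_pow, f.seq_pow ℓ n, map_one],
        fun n => by
          show g (f.seq ℓ (n + 1)) ^ ℓ = g (f.seq ℓ n)
          rw [← map_pow, f.seq_succ_pow ℓ n]⟩⟩
  map_add' := fun f f' => TateModule.ext ℓ fun n => by
    show g ((f + f').seq ℓ n) = g (f.seq ℓ n) * g (f'.seq ℓ n)
    rw [TateModule.seq_add, map_mul]
  map_smul' := fun c f => TateModule.ext ℓ fun n => by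
    show g ((c • f).seq ℓ n) = g (f.seq ℓ n) ^ (PadicInt.toZModPow n c).val
    rw [TateModule.seq_smul, map_pow]

lemma tateMap_seq {U V : Type} [CommGroup U] [CommGroup V] (g : U →* V)
    (f : TateModule ℓ U) (n : ℕ) : (tateMap ℓ g f).seq ℓ n = g (f.seq ℓ n) := rfl

lemma tate_bij {U V ι : Type} [CommGroup U] [CommGroup V] (g : ι → U →* V)
    (h : Function.Bijective (fun x : U => fun i => g i x)) :
    Function.Bijective (LinearMap.pi (fun i => tateMap ℓ (g i))) := by
  constructor
  · intro f f' hff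
    refine TateModule.ext ℓ fun n => h.1 (funext fun i => ?_)
    have := congrFun hff i
    exact congrArg (fun t => TateModule.seq ℓ t n) this
  · intro y
    choose u hu using fun n : ℕ => h.2 (fun i => (y i).seq ℓ n)
    have hu' : ∀ n i, g i (u n) = (y i).seq ℓ n := fun n i => congrFun (hu n) i
    refine ⟨Additive.ofMul (α := tateSubgroup ℓ U) ⟨u, fun n => h.1 (funext fun i => ?_),
      fun n => h.1 (funext fun i => ?_)⟩, funext fun i => TateModule.ext ℓ fun n => hu' n i⟩
    · show g i (u n ^ ℓ ^ n) = g i 1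
      rw [map_pow, hu', TateModule.seq_pow, map_one]
    · show g i (u (n + 1) ^ ℓ) = g i (u n)
      rw [map_pow, hu', hu', TateModule.seq_succ_pow]

lemma phi_equivariant (σ : Qbar ≃ₐ[ℚ] Qbar) (τ : F →ₐ[ℚ] Qbar) (x : F ⊗[ℚ] Qbar) :
    phi F τ (iota F σ x) = σ (phi F (galOnSigma F σ⁻¹ τ) x) := by
  induction x with
  | zero => simp
  | add x y hx hy => simp only [map_add, hx, hy]
  | tmul a b =>
    have h1 : iota F σ (a ⊗ₜ b) = a ⊗ₜ σ b := rfl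
    have h2 : σ (galOnSigma F σ⁻¹ τ a) = τ a := σ.apply_symm_apply (τ a)
    rw [h1, phi_tmul, phi_tmul, map_mul, h2]

/-- The integral isomorphism. -/
def tateEquiv [FiniteDimensional ℚ F] :
    TateModule ℓ ((F ⊗[ℚ] Qbar)ˣ) ≃ₗ[ℤ_[ℓ]] ((F →ₐ[ℚ] Qbar) → TateModule ℓ Qbarˣ) :=
  LinearEquiv.ofBijective
    (LinearMap.pi (fun τ : F →ₐ[ℚ] Qbar =>
      tateMap ℓ (Units.map ((phi F τ : F ⊗[ℚ] Qbar →* Qbar)))))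
    (tate_bij ℓ _ (units_bij _ (phi_bij F)))

lemma tateEquiv_equivariant [FiniteDimensional ℚ F] (σ : Qbar ≃ₐ[ℚ] Qbar)
    (f : TateModule ℓ ((F ⊗[ℚ] Qbar)ˣ)) (τ : F →ₐ[ℚ] Qbar) :
    tateEquiv ℓ F (tateAutRep ℓ ((F ⊗[ℚ] Qbar)ˣ)
        (algAutToUnitsAut F (F ⊗[ℚ] Qbar) (iota F σ)) f) τ
      = tateAutRep ℓ Qbarˣ (algAutToUnitsAut ℚ Qbar σ)
          (tateEquiv ℓ F f (galOnSigma F σ⁻¹ τ)) :=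
  TateModule.ext ℓ fun n => Units.ext (phi_equivariant F σ τ _)

end helpers

/-- There is a `ℚ_ℓ`-linear `Gal(Qbar/ℚ)`-equivariant isomorphism
`T ≅ (Σ → V)` (Shapiro/induced-module description of the Tate module of
`(F ⊗_ℚ Qbar)ˣ`). -/
theorem statement7 [FiniteDimensional ℚ F] (r : ℕ) (hdeg : Module.finrank ℚ F = r) :
    ∃ e : (ℚ_[ℓ] ⊗[ℤ_[ℓ]] TateModule ℓ ((F ⊗[ℚ] Qbar)ˣ)) ≃ₗ[ℚ_[ℓ]]
        ((F →ₐ[ℚ] Qbar) → ℚ_[ℓ] ⊗[ℤ_[ℓ]] TateModule ℓ Qbarˣ),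
      ∀ (σ : Qbar ≃ₐ[ℚ] Qbar) (t : ℚ_[ℓ] ⊗[ℤ_[ℓ]] TateModule ℓ ((F ⊗[ℚ] Qbar)ˣ)),
        e (tateRepT ℓ F σ t) = inducedRep ℓ F σ (e t) := by
  classical
  refine ⟨(tateEquiv ℓ F).baseChange ℤ_[ℓ] ℚ_[ℓ] _ _ ≪≫ₗ
    TensorProduct.piRight ℤ_[ℓ] ℚ_[ℓ] ℚ_[ℓ] (fun _ : F →ₐ[ℚ] Qbar => TateModule ℓ Qbarˣ), ?_⟩
  intro σ t
  induction t with
  | zero => simp only [map_zero]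
  | add x y hx hy => simp only [map_add, hx, hy]
  | tmul q f =>
    funext τ
    exact congrArg (fun z => q ⊗ₜ[ℤ_[ℓ]] z) (tateEquiv_equivariant ℓ F σ f τ)
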